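/- Consider the non-homogeneous problem in which the Dirichlet condition u(a_†,t) = 0 is replaced by u(a_†,t) = g(t) for a given smooth function g, and the correspondingly modified discretization operator Φ̃_h (identical to Φ_h except that P_M^n = (V_M^n − g(t^n))/h). Assume the consistency hypotheses (smooth data, Lipschitz dependence of d and B on s, thrice continuously differentiable bounded solution u of the non-homogeneous problem), the mesh coupling k = r·h² = λ·h with λ + 2r ≤ 1, and ‖U⁰ − u⁰‖ = O(h) as h → 0 (where U⁰ᵢ = u₀(xᵢ)). Then the scheme Φ̃_h(U_h) = 0 is convergent: there exists h₀ > 0 such that for all h ≤ h₀ it has a solution U_h ∈ X_h, and ‖u_h − U_h‖_{X_h} → 0 as h → 0. -/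

import Mathlib

open scoped BigOperators

noncomputable section

/-- Composite quadrature rule `Q_h`. -/
def Qh (h : ℝ) (M' : ℕ) (V : ℕ → ℝ) : ℝ :=
  (4*h/3) * (2*V 1 - V 2 + 2*V 3)
    + (h/3) * ∑ i ∈ Finset.Icc 2 M', (V (2*i) + 4*V (2*i+1) + V (2*i+2))
    + (4*h/3) * (2*V (2*M'+3) - V (2*M'+4) + 2*V (2*M'+5))

/-- `‖V‖² = Σ_{i=1}^{M-1} h |V_i|²`. -/
def normSq (h : ℝ) (M : ℕ) (V : ℕ → ℝ) : ℝ :=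
  ∑ i ∈ Finset.Icc 1 (M-1), h * (V i)^2

/-- `‖Z‖_*² = Σ_{n=0}^{N} k |Z^n|²`. -/
def starSq (k : ℝ) (N : ℕ) (Z : ℕ → ℝ) : ℝ :=
  ∑ n ∈ Finset.range (N+1), k * (Z n)^2

/-- The norm on `X_h`. -/
def XNorm (h k : ℝ) (M N : ℕ) (V0 : ℕ → ℝ) (V : ℕ → ℕ → ℝ) (VM : ℕ → ℝ) : ℝ :=
  h * (Real.sqrt (starSq k N V0) + Real.sqrt (starSq k N VM))
    + Finset.sup' (Finset.range (N+1)) ⟨0, Finset.mem_range.mpr (Nat.succ_pos N)⟩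
        (fun n => Real.sqrt (normSq h M (V n)))

/-- The square of the norm on `Y_h`. -/
def YNormSq (h k : ℝ) (M N : ℕ) (P0 : ℕ → ℝ) (P : ℕ → ℕ → ℝ) (PM : ℕ → ℝ) : ℝ :=
  starSq k N P0 + normSq h M (P 0) + h * starSq k N PM
    + ∑ n ∈ Finset.Icc 1 N, k * normSq h M (P n)

/-- Extension of an interior vector by the boundary entries. -/
def extV (M : ℕ) (V0 : ℕ → ℝ) (V : ℕ → ℕ → ℝ) (VM : ℕ → ℝ) (n i : ℕ) : ℝ :=
  if i = 0 then V0 n else if i = M then VM n else V n i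

/-- Boundary component `P_0^n` of `Φ_h`. -/
def phiP0 (h : ℝ) (M' : ℕ) (B : ℝ → ℝ → ℝ) (ψ2 : ℝ → ℝ)
    (V0 : ℕ → ℝ) (V : ℕ → ℕ → ℝ) (n : ℕ) : ℝ :=
  (1 + 1/h) * V0 n - (1/h) * V n 1
    - Qh h M' (fun i => B ((i:ℝ)*h) (Qh h M' (fun j => ψ2 ((j:ℝ)*h) * V n j)) * V n i)

/-- Boundary component `P_M^n` of `Φ_h`. -/
def phiPM (h : ℝ) (VM : ℕ → ℝ) (n : ℕ) : ℝ := VM n / h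

/-- Interior component `P_i^n` (for `1 ≤ n ≤ N`) of `Φ_h`. -/
def phiPi (h k : ℝ) (M' : ℕ) (d : ℝ → ℝ → ℝ) (ψ1 : ℝ → ℝ)
    (V0 : ℕ → ℝ) (V : ℕ → ℕ → ℝ) (VM : ℕ → ℝ) (n i : ℕ) : ℝ :=
  (V n i - V (n-1) i)/k
    + (extV (2*(M'+3)) V0 V VM (n-1) i - extV (2*(M'+3)) V0 V VM (n-1) (i-1))/h
    + d ((i:ℝ)*h) (Qh h M' (fun j => ψ1 ((j:ℝ)*h) * V (n-1) j)) * V (n-1) i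
    - (extV (2*(M'+3)) V0 V VM (n-1) (i+1) + extV (2*(M'+3)) V0 V VM (n-1) (i-1)
        - 2 * V (n-1) i)/h^2

/-- Interior component `P_i^n` of `Φ_h`, for all `0 ≤ n ≤ N`. -/
def phiP (h k : ℝ) (M' : ℕ) (d : ℝ → ℝ → ℝ) (ψ1 u0 : ℝ → ℝ)
    (V0 : ℕ → ℝ) (V : ℕ → ℕ → ℝ) (VM : ℕ → ℝ) (n i : ℕ) : ℝ :=
  if n = 0 then V 0 i - u0 ((i:ℝ)*h) else phiPi h k M' d ψ1 V0 V VM n i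

/-- `Φ̃_h(U_h) = 0`: the numerical scheme for the non-homogeneous Dirichlet condition
`u(a†, t) = g(t)`, whose operator differs from `Φ_h` only in `P_Mⁿ = (V_Mⁿ - g(tⁿ))/h`. -/
def SolvesG (adag T : ℝ) (d B : ℝ → ℝ → ℝ) (ψ1 ψ2 u0 g : ℝ → ℝ) (M' N : ℕ)
    (U0 : ℕ → ℝ) (U : ℕ → ℕ → ℝ) (UM : ℕ → ℝ) : Prop :=
  let M := 2*(M'+3); let h := adag / (M : ℝ); let k := T / (N : ℝ);
  (∀ n ≤ N, phiP0 h M' B ψ2 U0 U n = 0) ∧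
  (∀ n ≤ N, (UM n - g ((n:ℝ)*k)) / h = 0) ∧
  (∀ n ≤ N, ∀ i, 1 ≤ i → i ≤ M-1 → phiP h k M' d ψ1 u0 U0 U UM n i = 0)

/-- First order Taylor bound. -/
theorem abs_sub_sub_mul_deriv_le {f : ℝ → ℝ} {K : ℝ} (hf : ContDiff ℝ 2 f)
    (hK : ∀ x, |deriv (deriv f) x| ≤ K) (x h : ℝ) :
    |f (x + h) - f x - h * deriv f x| ≤ K * h ^ 2 := by
  have hK0 : 0 ≤ K := (abs_nonneg _).trans (hK 0)
  have hf1 : Differentiable ℝ f := hf.differentiable (by norm_num)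
  have hf2 : Differentiable ℝ (deriv f) :=
    (hf.iterate_deriv' 1 1).differentiable (by norm_num)
  have hlip : ∀ y, |deriv f y - deriv f x| ≤ K * |y - x| := fun y =>
    Convex.norm_image_sub_le_of_norm_deriv_le (s := Set.univ) (fun z _ => hf2 z)
      (fun z _ => hK z) convex_univ (Set.mem_univ x) (Set.mem_univ y)
  have hd : ∀ y, HasDerivAt (fun s => f s - s * deriv f x) (deriv f y - deriv f x) y := fun y => by
    simpa using (hf1 y).hasDerivAt.fun_sub ((hasDerivAt_id y).mul_const (deriv f x))
  have := Convex.norm_image_sub_le_of_norm_hasDerivWithin_le (s := Set.uIcc x (x + h))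
    (C := K * |h|) (fun y _ => (hd y).hasDerivWithinAt) (fun y hy => by
      refine (hlip y).trans (mul_le_mul_of_nonneg_left ?_ hK0)
      simpa using Set.abs_sub_left_of_mem_uIcc hy) (convex_uIcc x (x + h))
      Set.left_mem_uIcc Set.right_mem_uIcc
  simp only [Real.norm_eq_abs, add_sub_cancel_left] at this
  calc _ = |f (x + h) - (x + h) * deriv f x - (f x - x * deriv f x)| := by ring_nf
    _ ≤ K * |h| * |h| := this
    _ = K * h ^ 2 := by rw [mul_assoc, abs_mul_abs_self, sq]

theorem abs_second_difference_sub_le {f : ℝ → ℝ} {K : ℝ} (hf : ContDiff ℝ 3 f)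
    (hK : ∀ x, |deriv (deriv (deriv f)) x| ≤ K) (x : ℝ) {h : ℝ} (hh : 0 ≤ h) :
    |f (x + h) + f (x - h) - 2 * f x - h ^ 2 * deriv (deriv f) x| ≤ 2 * K * h ^ 3 := by
  have hK0 : 0 ≤ K := (abs_nonneg _).trans (hK 0)
  have hf1 : Differentiable ℝ f := hf.differentiable (by norm_num)
  have hf2 : ContDiff ℝ 2 (deriv f) := hf.iterate_deriv' 2 1
  have hd : ∀ s, HasDerivAt (fun s => f (x + s) + f (x - s) - s ^ 2 * deriv (deriv f) x)
      (deriv f (x + s) - deriv f (x - s) - 2 * s * deriv (deriv f) x) s := fun s => by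
    have h1 : HasDerivAt (fun s => f (x + s)) (deriv f (x + s)) s :=
      (hf1 (x + s)).hasDerivAt.comp_const_add x s
    have h2 : HasDerivAt (fun s => f (x - s)) (-deriv f (x - s)) s :=
      (hf1 (x - s)).hasDerivAt.comp_const_sub x s
    have h3 := (hasDerivAt_pow 2 s).mul_const (deriv (deriv f) x)
    exact ((h1.fun_add h2).fun_sub h3).congr_deriv (by push_cast; ring)
  have hb : ∀ s ∈ Set.Icc 0 h,
      ‖deriv f (x + s) - deriv f (x - s) - 2 * s * deriv (deriv f) x‖ ≤ 2 * K * h ^ 2 := by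
    intro s hs
    have h1 := abs_sub_sub_mul_deriv_le hf2 hK x s
    have h2 := abs_sub_sub_mul_deriv_le hf2 hK x (-s)
    have h3 : K * s ^ 2 ≤ K * h ^ 2 :=
      mul_le_mul_of_nonneg_left (pow_le_pow_left₀ hs.1 hs.2 2) hK0
    rw [← sub_eq_add_neg] at h2
    rw [abs_le] at h1 h2
    rw [Real.norm_eq_abs, abs_le]
    constructor <;> nlinarith
  have := Convex.norm_image_sub_le_of_norm_hasDerivWithin_le (s := Set.Icc 0 h)
    (fun y _ => (hd y).hasDerivWithinAt) hb (convex_Icc 0 h)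
    (Set.left_mem_Icc.2 hh) (Set.right_mem_Icc.2 hh)
  simp only [Real.norm_eq_abs, sub_zero, add_zero, abs_of_nonneg hh] at this
  calc _ = _ := by congr 1; ring
    _ ≤ 2 * K * h ^ 2 * h := this
    _ = _ := by ring

theorem abs_iteratedDeriv_comp_line_le {F : ℝ × ℝ → ℝ} {m : ℕ} {K : ℝ} (hF : ContDiff ℝ m F)
    (hK : ∀ p, ‖iteratedFDeriv ℝ m F p‖ ≤ K) (p : ℝ × ℝ) (A : ℝ →L[ℝ] ℝ × ℝ) (hA : ‖A‖ ≤ 1)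
    (x : ℝ) : |iteratedDeriv m (fun s => F (p + A s)) x| ≤ K := by
  rw [← Real.norm_eq_abs, ← norm_iteratedFDeriv_eq_norm_iteratedDeriv]
  have h1 : ContDiff ℝ m (fun q => F (p + q)) := hF.comp (contDiff_const.add contDiff_id)
  have := A.iteratedFDeriv_comp_right h1 x (i := m) le_rfl
  have h2 : (fun s => F (p + A s)) = (fun q => F (p + q)) ∘ A := rfl
  rw [h2, this, iteratedFDeriv_comp_add_left]
  refine (ContinuousMultilinearMap.norm_compContinuousLinearMap_le _ _).trans ?_
  have h3 : (∏ _i : Fin m, ‖A‖) ≤ 1 := Finset.prod_le_one (fun _ _ => norm_nonneg _) fun _ _ => hA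
  calc _ ≤ ‖iteratedFDeriv ℝ m F (p + A x)‖ * 1 := mul_le_mul_of_nonneg_left h3 (norm_nonneg _)
    _ ≤ K := by simpa using hK _

theorem Qh_sub (h : ℝ) (M' : ℕ) (V W : ℕ → ℝ) :
    Qh h M' V - Qh h M' W = Qh h M' (fun i => V i - W i) := by
  have : ∑ i ∈ Finset.Icc 2 M', (V (2*i) - W (2*i) + 4*(V (2*i+1) - W (2*i+1))
        + (V (2*i+2) - W (2*i+2)))
      = ∑ i ∈ Finset.Icc 2 M', (V (2*i) + 4*V (2*i+1) + V (2*i+2))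
        - ∑ i ∈ Finset.Icc 2 M', (W (2*i) + 4*W (2*i+1) + W (2*i+2)) := by
    rw [← Finset.sum_sub_distrib]
    exact Finset.sum_congr rfl fun i _ => by ring
  simp only [Qh, this]
  ring

theorem abs_Qh_le {a h c : ℝ} {M' : ℕ} {V : ℕ → ℝ} (hh : 0 ≤ h)
    (ha : h * (2 * ((M' : ℝ) + 3)) = a)
    (hV : ∀ i, 1 ≤ i → i ≤ 2 * (M' + 3) - 1 → |V i| ≤ c) : |Qh h M' V| ≤ 3 * a * c := by
  have hc : 0 ≤ c := (abs_nonneg _).trans (hV 1 le_rfl (by omega))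
  have hS : |∑ i ∈ Finset.Icc 2 M', (V (2*i) + 4*V (2*i+1) + V (2*i+2))| ≤ M' * (6 * c) := by
    refine (Finset.abs_sum_le_sum_abs _ _).trans ?_
    refine (Finset.sum_le_card_nsmul _ _ (6 * c) fun i hi => ?_).trans ?_
    · rw [Finset.mem_Icc] at hi
      have h1 := abs_le.1 (hV (2*i) (by omega) (by omega))
      have h2 := abs_le.1 (hV (2*i+1) (by omega) (by omega))
      have h3 := abs_le.1 (hV (2*i+2) (by omega) (by omega))
      rw [abs_le]
      constructor <;> linarith
    · rw [nsmul_eq_mul]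
      refine mul_le_mul_of_nonneg_right ?_ (by positivity)
      rw [Nat.card_Icc]
      exact_mod_cast (by omega : M' + 1 - 2 ≤ M')
  have h1 := abs_le.1 (hV 1 (by omega) (by omega))
  have h2 := abs_le.1 (hV 2 (by omega) (by omega))
  have h3 := abs_le.1 (hV 3 (by omega) (by omega))
  have h4 := abs_le.1 (hV (2*M'+3) (by omega) (by omega))
  have h5 := abs_le.1 (hV (2*M'+4) (by omega) (by omega))
  have h6 := abs_le.1 (hV (2*M'+5) (by omega) (by omega))
  have key : |4 * (2*V 1 - V 2 + 2*V 3)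
      + ∑ i ∈ Finset.Icc 2 M', (V (2*i) + 4*V (2*i+1) + V (2*i+2))
      + 4 * (2*V (2*M'+3) - V (2*M'+4) + 2*V (2*M'+5))| ≤ (40 + 6 * M') * c := by
    rw [abs_le] at hS ⊢
    constructor <;> linarith
  calc |Qh h M' V| = h / 3 * |4 * (2*V 1 - V 2 + 2*V 3)
      + ∑ i ∈ Finset.Icc 2 M', (V (2*i) + 4*V (2*i+1) + V (2*i+2))
      + 4 * (2*V (2*M'+3) - V (2*M'+4) + 2*V (2*M'+5))| := by
        rw [← abs_of_nonneg (by positivity : 0 ≤ h / 3), ← abs_mul, Qh]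
        congr 1; ring
    _ ≤ h / 3 * ((40 + 6 * M') * c) := mul_le_mul_of_nonneg_left key (by positivity)
    _ ≤ 3 * a * c := by
      have : 0 ≤ h * c := mul_nonneg hh hc
      have : 0 ≤ h * c * M' := by positivity
      rw [← ha]; nlinarith

/-- One-point rectangle rule for a Lipschitz integrand. -/
theorem abs_integral_sub_mul_le {f : ℝ → ℝ} {a b y K : ℝ} (hf : Continuous f) (hab : a ≤ b)
    (hy : y ∈ Set.Icc a b) (hK0 : 0 ≤ K)
    (hK : ∀ x ∈ Set.Icc a b, ∀ z ∈ Set.Icc a b, |f x - f z| ≤ K * |x - z|) :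
    |(∫ x in a..b, f x) - (b - a) * f y| ≤ K * (b - a) ^ 2 := by
  have h1 : (∫ x in a..b, f x) - (b - a) * f y = ∫ x in a..b, (f x - f y) := by
    rw [intervalIntegral.integral_sub (hf.intervalIntegrable _ _) (by simp)]
    simp
  have h2 := intervalIntegral.norm_integral_le_of_norm_le_const (a := a) (b := b)
    (C := K * (b - a)) (f := fun x => f x - f y) (fun x hx => by
      rw [Set.uIoc_of_le hab] at hx
      have hx' : x ∈ Set.Icc a b := ⟨hx.1.le, hx.2⟩
      refine (hK x hx' y hy).trans (mul_le_mul_of_nonneg_left ?_ hK0)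
      rw [abs_le]
      constructor <;> linarith [hx'.1, hx'.2, hy.1, hy.2])
  rw [h1]
  rw [Real.norm_eq_abs, abs_of_nonneg (sub_nonneg.2 hab)] at h2
  exact h2.trans_eq (by ring)

theorem abs_milne_sub_integral_le {f : ℝ → ℝ} {a h K : ℝ} (hf : Continuous f) (hh : 0 ≤ h)
    (hK0 : 0 ≤ K)
    (hK : ∀ x ∈ Set.Icc a (a + 4 * h), ∀ z ∈ Set.Icc a (a + 4 * h), |f x - f z| ≤ K * |x - z|) :
    |4 * h / 3 * (2 * f (a + h) - f (a + 2 * h) + 2 * f (a + 3 * h))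
      - ∫ x in a..a + 4 * h, f x| ≤ 22 * K * h ^ 2 := by
  have h0 := abs_le.1 (abs_integral_sub_mul_le hf (by linarith : a ≤ a + 4 * h)
    (y := a + 2 * h) ⟨by linarith, by linarith⟩ hK0 hK)
  have h1 := hK (a + h) ⟨by linarith, by linarith⟩ (a + 2 * h) ⟨by linarith, by linarith⟩
  have h2 := hK (a + 3 * h) ⟨by linarith, by linarith⟩ (a + 2 * h) ⟨by linarith, by linarith⟩
  rw [show a + h - (a + 2 * h) = -h by ring, abs_neg, abs_of_nonneg hh, abs_le] at h1
  rw [show a + 3 * h - (a + 2 * h) = h by ring, abs_of_nonneg hh, abs_le] at h2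
  have hKh : 0 ≤ K * h ^ 2 := by positivity
  rw [abs_le]
  constructor <;> nlinarith

theorem abs_simpson_sub_integral_le {f : ℝ → ℝ} {a h K : ℝ} (hf : Continuous f) (hh : 0 ≤ h)
    (hK0 : 0 ≤ K)
    (hK : ∀ x ∈ Set.Icc a (a + 2 * h), ∀ z ∈ Set.Icc a (a + 2 * h), |f x - f z| ≤ K * |x - z|) :
    |h / 3 * (f a + 4 * f (a + h) + f (a + 2 * h)) - ∫ x in a..a + 2 * h, f x|
      ≤ 5 * K * h ^ 2 := by
  have h0 := abs_le.1 (abs_integral_sub_mul_le hf (by linarith : a ≤ a + 2 * h)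
    (y := a + h) ⟨by linarith, by linarith⟩ hK0 hK)
  have h1 := hK a ⟨by linarith, by linarith⟩ (a + h) ⟨by linarith, by linarith⟩
  have h2 := hK (a + 2 * h) ⟨by linarith, by linarith⟩ (a + h) ⟨by linarith, by linarith⟩
  rw [show a - (a + h) = -h by ring, abs_neg, abs_of_nonneg hh, abs_le] at h1
  rw [show a + 2 * h - (a + h) = h by ring, abs_of_nonneg hh, abs_le] at h2
  have hKh : 0 ≤ K * h ^ 2 := by positivity
  rw [abs_le]
  constructor <;> nlinarith

theorem abs_sum_simpson_sub_integral_le {f : ℝ → ℝ} {h K : ℝ} (hf : Continuous f) (hh : 0 ≤ h)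
    (hK0 : 0 ≤ K) {n : ℕ} (hn : 1 ≤ n)
    (hK : ∀ x ∈ Set.Icc 0 ((2 * n + 2) * h), ∀ z ∈ Set.Icc 0 ((2 * n + 2) * h),
      |f x - f z| ≤ K * |x - z|) :
    |h / 3 * ∑ i ∈ Finset.Icc 2 n, (f ((2*i : ℕ) * h) + 4 * f ((2*i+1 : ℕ) * h)
        + f ((2*i+2 : ℕ) * h)) - ∫ x in (4 * h)..((2 * n + 2) * h), f x|
      ≤ 5 * K * h ^ 2 * n := by
  induction n, hn using Nat.le_induction with
  | base =>
    norm_num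
    positivity
  | succ n hn ih =>
    have hle : (2 * (n : ℝ) + 2) * h ≤ (2 * ((n + 1 : ℕ) : ℝ) + 2) * h := by
      refine mul_le_mul_of_nonneg_right ?_ hh
      push_cast; linarith
    have ih' := ih fun x hx z hz => hK x ⟨hx.1, hx.2.trans hle⟩ z ⟨hz.1, hz.2.trans hle⟩
    have he : (2 * ((n + 1 : ℕ) : ℝ) + 2) * h = (2 * n + 2) * h + 2 * h := by push_cast; ring
    have hp := abs_simpson_sub_integral_le (a := (2 * n + 2) * h) hf hh hK0 (by
      rw [← he]
      have h0 : 0 ≤ (2 * (n : ℝ) + 2) * h := by positivity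
      exact fun x hx z hz => hK x ⟨h0.trans hx.1, hx.2⟩ z ⟨h0.trans hz.1, hz.2⟩)
    rw [Finset.sum_Icc_succ_top (by omega), he,
      ← intervalIntegral.integral_add_adjacent_intervals (b := (2 * n + 2) * h)
        (hf.intervalIntegrable _ _) (hf.intervalIntegrable _ _)]
    have e0 : ((2 * (n + 1) : ℕ) : ℝ) * h = (2 * n + 2) * h := by push_cast; ring
    have e1 : ((2 * (n + 1) + 1 : ℕ) : ℝ) * h = (2 * n + 2) * h + h := by push_cast; ring
    have e2 : ((2 * (n + 1) + 2 : ℕ) : ℝ) * h = (2 * n + 2) * h + 2 * h := by push_cast; ring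
    rw [e0, e1, e2]
    rw [abs_le] at ih' hp ⊢
    push_cast at ih' ⊢
    constructor <;> linarith

/-- The quadrature rule is first order accurate on Lipschitz functions. -/
theorem abs_Qh_sub_integral_le {f : ℝ → ℝ} {a h K : ℝ} {M' : ℕ} (hM' : 0 < M')
    (hf : Continuous f) (hh : 0 ≤ h) (ha : h * (2 * ((M' : ℝ) + 3)) = a) (hK0 : 0 ≤ K)
    (hK : ∀ x ∈ Set.Icc 0 a, ∀ z ∈ Set.Icc 0 a, |f x - f z| ≤ K * |x - z|) :
    |Qh h M' (fun i => f (i * h)) - ∫ x in (0:ℝ)..a, f x| ≤ 8 * a * K * h := by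
  have hmh : 0 ≤ (M' : ℝ) * h := by positivity
  have h1 := abs_milne_sub_integral_le (a := 0) hf hh hK0 fun x hx z hz =>
    hK x ⟨hx.1, by linarith [hx.2]⟩ z ⟨hz.1, by linarith [hz.2]⟩
  have h2 := abs_sum_simpson_sub_integral_le hf hh hK0 (n := M') hM' fun x hx z hz =>
    hK x ⟨hx.1, by linarith [hx.2]⟩ z ⟨hz.1, by linarith [hz.2]⟩
  have h3 := abs_milne_sub_integral_le (a := (2 * M' + 2) * h) hf hh hK0 fun x hx z hz =>
    hK x ⟨by linarith [hx.1], by linarith [hx.2]⟩ z ⟨by linarith [hz.1], by linarith [hz.2]⟩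
  have hsplit : ∫ x in (0:ℝ)..a, f x = (∫ x in (0:ℝ)..0 + 4 * h, f x)
      + (∫ x in (4 * h)..((2 * M' + 2) * h), f x)
      + ∫ x in ((2 * M' + 2) * h)..((2 * M' + 2) * h + 4 * h), f x := by
    rw [zero_add, intervalIntegral.integral_add_adjacent_intervals (hf.intervalIntegrable _ _)
      (hf.intervalIntegrable _ _), intervalIntegral.integral_add_adjacent_intervals
      (hf.intervalIntegrable _ _) (hf.intervalIntegrable _ _), ← ha]
    congr 1; ring
  have e1 : (((2 * M' + 3 : ℕ) : ℝ) * h) = (2 * M' + 2) * h + h := by push_cast; ring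
  have e2 : (((2 * M' + 4 : ℕ) : ℝ) * h) = (2 * M' + 2) * h + 2 * h := by push_cast; ring
  have e3 : (((2 * M' + 5 : ℕ) : ℝ) * h) = (2 * M' + 2) * h + 3 * h := by push_cast; ring
  have e4 : ((1 : ℕ) : ℝ) * h = 0 + h := by push_cast; ring
  have e5 : ((2 : ℕ) : ℝ) * h = 0 + 2 * h := by push_cast; ring
  have e6 : ((3 : ℕ) : ℝ) * h = 0 + 3 * h := by push_cast; ring
  have hb : 22 * K * h ^ 2 + 5 * K * h ^ 2 * M' + 22 * K * h ^ 2 ≤ 8 * a * K * h := by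
    have : 0 ≤ K * h ^ 2 := by positivity
    have : 0 ≤ K * h ^ 2 * M' := by positivity
    rw [← ha]; nlinarith
  rw [hsplit, Qh, e1, e2, e3, e4, e5, e6]
  refine le_trans ?_ hb
  rw [abs_le] at h1 h2 h3 ⊢
  constructor <;> linarith

theorem Qh_congr {h : ℝ} (hh : 0 ≤ h) {M' : ℕ} {V W : ℕ → ℝ}
    (hVW : ∀ i, 1 ≤ i → i ≤ 2 * (M' + 3) - 1 → V i = W i) : Qh h M' V = Qh h M' W := by
  have := abs_Qh_le (c := 0) hh rfl (V := fun i => V i - W i) (M' := M')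
    fun i h1 h2 => by simp [hVW i h1 h2]
  rw [← Qh_sub, mul_zero] at this
  exact sub_eq_zero.1 (abs_nonpos_iff.1 this)

/-- `W` is a grid function, boundary nodes included, that solves the numerical scheme. -/
structure IsGridSolution (h k : ℝ) (M' N : ℕ) (d B : ℝ → ℝ → ℝ) (ψ1 ψ2 u0 g : ℝ → ℝ)
    (W : ℕ → ℕ → ℝ) : Prop where
  left : ∀ n ≤ N, (1 + 1/h) * W n 0 - (1/h) * W n 1
    - Qh h M' (fun i => B ((i:ℝ)*h) (Qh h M' (fun j => ψ2 ((j:ℝ)*h) * W n j)) * W n i) = 0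
  right : ∀ n ≤ N, W n (2 * (M' + 3)) = g (n * k)
  init : ∀ i, 1 ≤ i → i ≤ 2 * (M' + 3) - 1 → W 0 i = u0 (i * h)
  step : ∀ n < N, ∀ i, 1 ≤ i → i ≤ 2 * (M' + 3) - 1 →
    (W (n + 1) i - W n i)/k + (W n i - W n (i-1))/h
      + d ((i:ℝ)*h) (Qh h M' (fun j => ψ1 ((j:ℝ)*h) * W n j)) * W n i
      - (W n (i+1) + W n (i-1) - 2 * W n i)/h^2 = 0

/-- The scheme is explicit, hence uniquely solvable. -/
theorem exists_isGridSolution {h k : ℝ} (hh : 0 < h) (hk : 0 < k) (M' N : ℕ)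
    (d B : ℝ → ℝ → ℝ) (ψ1 ψ2 u0 g : ℝ → ℝ) :
    ∃ W, IsGridSolution h k M' N d B ψ1 ψ2 u0 g W := by
  let close : ℝ → (ℕ → ℝ) → ℕ → ℝ := fun c V i =>
    if i = 0 then ((1/h) * V 1 + Qh h M' (fun i => B ((i:ℝ)*h)
      (Qh h M' (fun j => ψ2 ((j:ℝ)*h) * V j)) * V i)) / (1 + 1/h)
    else if i = 2 * (M' + 3) then c else V i
  let next : (ℕ → ℝ) → ℕ → ℝ := fun V i =>
    V i - k * ((V i - V (i-1))/h
      + d ((i:ℝ)*h) (Qh h M' (fun j => ψ1 ((j:ℝ)*h) * V j)) * V i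
      - (V (i+1) + V (i-1) - 2 * V i)/h^2)
  let W : ℕ → ℕ → ℝ := fun n => Nat.rec (close (g 0) (fun i => u0 (i * h)))
    (fun n V => close (g ((n + 1 : ℕ) * k)) (next V)) n
  have hclose : ∀ c V i, 1 ≤ i → i ≤ 2 * (M' + 3) - 1 → close c V i = V i := by
    intro c V i h1 h2
    simp only [close]
    rw [if_neg (by omega), if_neg (by omega)]
  have hW : ∀ n, ∃ V, W n = close (g (n * k)) V := by
    rintro (_ | n)
    · exact ⟨_, by simp [W]; rfl⟩
    · exact ⟨_, rfl⟩
  refine ⟨W, ?_, ?_, ?_, ?_⟩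
  · intro n _
    obtain ⟨V, hV⟩ := hW n
    rw [hV, hclose _ _ 1 le_rfl (by omega),
      Qh_congr hh.le (V := fun j : ℕ => ψ2 ((j:ℝ)*h) * close (g (n * k)) V j)
        (W := fun j : ℕ => ψ2 ((j:ℝ)*h) * V j)
        (fun i h1 h2 => by simp only [hclose _ _ i h1 h2]),
      Qh_congr hh.le (W := fun i : ℕ => B ((i:ℝ)*h)
        (Qh h M' (fun j => ψ2 ((j:ℝ)*h) * V j)) * V i)
        (fun i h1 h2 => by simp only [hclose _ _ i h1 h2])]
    simp only [close, if_true]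
    have : 1 + 1 / h ≠ 0 := by positivity
    rw [mul_div_cancel₀ _ this]
    ring
  · intro n _
    obtain ⟨V, hV⟩ := hW n
    simp [hV, close]
  · intro i h1 h2
    exact hclose (g 0) (fun i => u0 (i * h)) i h1 h2
  · intro n _ i h1 h2
    have : W (n + 1) i = next (W n) i := hclose _ _ i h1 h2
    rw [this]
    simp only [next]
    have hk' := hk.ne'
    field_simp
    ring

theorem IsGridSolution.solvesG {a T : ℝ} {M' N : ℕ} {d B : ℝ → ℝ → ℝ}
    {ψ1 ψ2 u0 g : ℝ → ℝ} {W : ℕ → ℕ → ℝ}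
    (hW : IsGridSolution (a / ((2 * (M' + 3) : ℕ) : ℝ)) (T / N) M' N d B ψ1 ψ2 u0 g W) :
    SolvesG a T d B ψ1 ψ2 u0 g M' N (fun n => W n 0) W (fun n => W n (2 * (M' + 3))) := by
  have hext : ∀ n i, extV (2 * (M' + 3)) (fun n => W n 0) W (fun n => W n (2 * (M' + 3))) n i
      = W n i := by
    intro n i
    unfold extV
    split_ifs with h1 h2
    · rw [h1]
    · rw [h2]
    · rfl
  refine ⟨hW.left, fun n hn => by simp only [hW.right n hn, sub_self, zero_div], ?_⟩
  rintro (_ | n) hn i h1 h2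
  · simp [phiP, hW.init i h1 h2]
  · simpa only [phiP, phiPi, hext, Nat.add_sub_cancel, if_neg (Nat.succ_ne_zero n)] using
      hW.step n (by omega) i h1 h2

theorem abs_nonlocal_sub_le {a h K G s : ℝ} {M' : ℕ} {ψ : ℝ → ℝ} {v V : ℕ → ℝ} (hh : 0 ≤ h)
    (ha : h * (2 * ((M' : ℝ) + 3)) = a)
    (hψ : ∀ i, 1 ≤ i → i ≤ 2 * (M' + 3) - 1 → |ψ ((i : ℝ) * h)| ≤ K)
    (hs : |Qh h M' (fun j => ψ ((j : ℝ) * h) * v j) - s| ≤ K * h)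
    (he : ∀ i, 1 ≤ i → i ≤ 2 * (M' + 3) - 1 → |v i - V i| ≤ G) :
    |s - Qh h M' (fun j => ψ ((j : ℝ) * h) * V j)| ≤ K * h + 3 * a * (K * G) := by
  have h1 := abs_Qh_le (c := K * G) hh ha
    (V := fun j => ψ ((j : ℝ) * h) * v j - ψ ((j : ℝ) * h) * V j) (fun i h1 h2 => by
      rw [← mul_sub, abs_mul]
      exact mul_le_mul (hψ i h1 h2) (he i h1 h2) (abs_nonneg _)
        ((abs_nonneg _).trans (hψ i h1 h2)))
  rw [← Qh_sub] at h1
  rw [abs_le] at *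
  constructor <;> linarith

/-- Local Lipschitz bound for the nonlinear terms. -/
theorem abs_coeff_mul_sub_le {a h K L G s S v V : ℝ} {F : ℝ → ℝ} (hL : 0 ≤ L) (hK : 0 ≤ K)
    (ha : 0 ≤ a) (hhG : h ≤ G) (hG1 : G ≤ 1) (hF : |F s| ≤ K)
    (hLip : |F s - F S| ≤ L * |s - S|) (hs : |s - S| ≤ K * h + 3 * a * (K * G))
    (hv : |v| ≤ K) (hV : |v - V| ≤ G) :
    |F s * v - F S * V| ≤ (K + L * (K * (1 + 3 * a)) * (K + 1)) * G := by
  have hG0 : 0 ≤ G := (abs_nonneg _).trans hV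
  have hVb : |V| ≤ K + 1 := by
    rw [abs_le] at *
    constructor <;> linarith
  have hs' : |s - S| ≤ K * (1 + 3 * a) * G := by
    have := mul_le_mul_of_nonneg_left hhG hK
    linarith
  have h1 : |F s * (v - V)| ≤ K * G := by
    rw [abs_mul]; exact mul_le_mul hF hV (abs_nonneg _) hK
  have h2 : |(F s - F S) * V| ≤ L * (K * (1 + 3 * a) * G) * (K + 1) := by
    rw [abs_mul]
    exact mul_le_mul (hLip.trans (mul_le_mul_of_nonneg_left hs' hL)) hVb (abs_nonneg _)
      (by positivity)
  calc _ = |F s * (v - V) + (F s - F S) * V| := by ring_nf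
    _ ≤ _ := abs_add_le _ _
    _ ≤ K * G + L * (K * (1 + 3 * a) * G) * (K + 1) := add_le_add h1 h2
    _ = _ := by ring

/-- The discrete Robin condition preserves the weighted maximum bound. -/
theorem abs_boundary_error_le {h K α b G e₀ e₁ D ρ : ℝ} (hh : 0 < h)
    (hα : α = 2 * (b + 2 * K)) (hα0 : 0 < α) (hαh : α * h ≤ 1) (hG : 0 ≤ G) (hhG : h ≤ G)
    (hK : 0 ≤ K)
    (heq : (1 + 1/h) * e₀ - (1/h) * e₁ - D = ρ) (hD : |D| ≤ b * G) (hρ : |ρ| ≤ 2 * K * h)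
    (he : |e₁| ≤ G * (1 + α * h)⁻¹) : |e₀| ≤ G := by
  have hy : 0 ≤ α * h := by positivity
  have h1 : (1 + α * h)⁻¹ ≤ 1 - α * h / 2 := by
    rw [inv_le_iff_one_le_mul₀ (by positivity)]
    nlinarith
  have h2 : (1 + h) * e₀ = e₁ + h * D + h * ρ := by
    field_simp at heq
    linarith
  have h3 : |(1 + h) * e₀| ≤ (1 + h) * G := by
    rw [h2]
    calc _ ≤ |e₁| + |h * D| + |h * ρ| := abs_add_three _ _ _
      _ ≤ G * (1 - α * h / 2) + h * (b * G) + h * (2 * K * G) := by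
        rw [abs_mul, abs_mul, abs_of_pos hh]
        have := mul_le_mul_of_nonneg_left hhG (by positivity : 0 ≤ 2 * K)
        gcongr
        · exact he.trans (mul_le_mul_of_nonneg_left h1 hG)
        · exact hρ.trans this
      _ = G := by rw [hα]; ring
      _ ≤ (1 + h) * G := by nlinarith
  rw [abs_mul, abs_of_pos (by positivity)] at h3
  exact le_of_mul_le_mul_left h3 (by positivity)

/-- One explicit step preserves the weighted maximum bound up to a factor `1 + O(k)`. -/
theorem abs_step_error_le {h k K α A c₀ G w e' e em ep D ρ : ℝ} (hh : 0 < h) (hk : 0 < k)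
    (hcfl : k / h + 2 * (k / h ^ 2) ≤ 1) (hα : 0 < α) (hG : 0 ≤ G) (hw : 0 ≤ w)
    (hA : 0 ≤ A) (hK : 0 ≤ K) (hc : 1 ≤ c₀ * w)
    (heq : (e' - e) / k + (e - em) / h + D - (ep + em - 2 * e) / h ^ 2 = ρ)
    (he : |e| ≤ G * w) (hem : |em| ≤ G * (w * (1 + α * h))) (hep : |ep| ≤ G * (w * (1 + α * h)⁻¹))
    (hD : |D| ≤ A * G) (hρ : |ρ| ≤ 2 * K * G) :
    |e'| ≤ G * (1 + (α + α ^ 2 + (A + 2 * K) * c₀) * k) * w := by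
  set lam := k / h with hlam
  set r := k / h ^ 2 with hr
  have hl0 : 0 ≤ lam := by positivity
  have hr0 : 0 ≤ r := by positivity
  have hlk : lam * h = k := by rw [hlam]; field_simp
  have hrk : r * h ^ 2 = k := by rw [hr]; field_simp
  have h1 : e' = (1 - lam - 2 * r) * e + (lam + r) * em + r * ep + k * (ρ - D) := by
    rw [hlam, hr, ← heq]; field_simp; ring
  have h2 : |ρ - D| ≤ (A + 2 * K) * G := by
    rw [abs_le] at *
    constructor <;> linarith
  have hinv : (1 + α * h)⁻¹ ≤ 1 - α * h + (α * h) ^ 2 := by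
    have : 0 ≤ α * h := by positivity
    rw [inv_le_iff_one_le_mul₀ (by positivity)]
    nlinarith [pow_nonneg this 3]
  have hGw : 0 ≤ G * w := by positivity
  have h3 : |k * (ρ - D)| ≤ k * ((A + 2 * K) * c₀) * (G * w) := by
    rw [abs_mul, abs_of_pos hk]
    have : (A + 2 * K) * G * 1 ≤ (A + 2 * K) * G * (c₀ * w) :=
      mul_le_mul_of_nonneg_left hc (by positivity)
    nlinarith
  have h4 : |(1 - lam - 2 * r) * e| ≤ (1 - lam - 2 * r) * (G * w) := by
    rw [abs_mul, abs_of_nonneg (by linarith)]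
    exact mul_le_mul_of_nonneg_left he (by linarith)
  have h5 : |(lam + r) * em| ≤ (lam + r) * (G * (w * (1 + α * h))) := by
    rw [abs_mul, abs_of_nonneg (by positivity)]
    exact mul_le_mul_of_nonneg_left hem (by positivity)
  have h6 : |r * ep| ≤ r * (G * w * (1 - α * h + (α * h) ^ 2)) := by
    rw [abs_mul, abs_of_nonneg hr0]
    refine mul_le_mul_of_nonneg_left (hep.trans ?_) hr0
    rw [← mul_assoc]
    exact mul_le_mul_of_nonneg_left hinv hGw
  calc |e'| ≤ |(1 - lam - 2 * r) * e| + |(lam + r) * em| + |r * ep| + |k * (ρ - D)| := by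
        rw [h1]
        exact (abs_add_le _ _).trans (add_le_add_left (abs_add_three _ _ _) _)
    _ ≤ (1 - lam - 2 * r) * (G * w) + (lam + r) * (G * (w * (1 + α * h)))
        + r * (G * w * (1 - α * h + (α * h) ^ 2)) + k * ((A + 2 * K) * c₀) * (G * w) := by
        linarith
    _ = G * w * (1 + α * (lam * h) + α ^ 2 * (r * h ^ 2) + k * ((A + 2 * K) * c₀)) := by ring
    _ = _ := by rw [hlk, hrk]; ring

/-- The exact solution satisfies the scheme up to a first order truncation error; the constant `K`
also bounds the solution and the coefficients along it. -/
structure IsConsistent (a T K : ℝ) (d B : ℝ → ℝ → ℝ) (ψ1 ψ2 : ℝ → ℝ) (u : ℝ → ℝ → ℝ)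
    (s1 s2 : ℝ → ℝ) : Prop where
  one_le : 1 ≤ K
  abs_u_le : ∀ x ∈ Set.Icc 0 a, ∀ t ∈ Set.Icc 0 T, |u x t| ≤ K
  abs_d_le : ∀ x ∈ Set.Icc 0 a, ∀ t ∈ Set.Icc 0 T, |d x (s1 t)| ≤ K
  abs_B_le : ∀ x ∈ Set.Icc 0 a, ∀ t ∈ Set.Icc 0 T, |B x (s2 t)| ≤ K
  abs_psi1_le : ∀ x ∈ Set.Icc 0 a, |ψ1 x| ≤ K
  abs_psi2_le : ∀ x ∈ Set.Icc 0 a, |ψ2 x| ≤ K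
  quad1 : ∀ t ∈ Set.Icc 0 T, ∀ (h : ℝ) (M' : ℕ), 0 < M' → 0 < h →
    h * (2 * ((M' : ℝ) + 3)) = a →
    |Qh h M' (fun j => ψ1 ((j : ℝ) * h) * u ((j : ℝ) * h) t) - s1 t| ≤ K * h
  quad2 : ∀ t ∈ Set.Icc 0 T, ∀ (h : ℝ) (M' : ℕ), 0 < M' → 0 < h →
    h * (2 * ((M' : ℝ) + 3)) = a →
    |Qh h M' (fun j => ψ2 ((j : ℝ) * h) * u ((j : ℝ) * h) t) - s2 t| ≤ K * h
  robin : ∀ t ∈ Set.Icc 0 T, ∀ (h : ℝ) (M' : ℕ), 0 < M' → 0 < h →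
    h * (2 * ((M' : ℝ) + 3)) = a →
    |(1 + 1/h) * u 0 t - (1/h) * u h t
      - Qh h M' (fun j => B ((j : ℝ) * h) (s2 t) * u ((j : ℝ) * h) t)| ≤ 2 * K * h
  interior : ∀ t ∈ Set.Icc 0 T, ∀ x ∈ Set.Ioo 0 a, ∀ h k : ℝ, 0 < h → 0 < k →
    |(u x (t + k) - u x t) / k + (u x t - u (x - h) t) / h + d x (s1 t) * u x t
      - (u (x + h) t + u (x - h) t - 2 * u x t) / h ^ 2| ≤ K * (h + k)

/-- Weighted maximum-norm error bound for the scheme. -/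
theorem IsConsistent.abs_error_le {a T K L h k α A c₀ : ℝ} {d B : ℝ → ℝ → ℝ}
    {ψ1 ψ2 u0 g : ℝ → ℝ} {u : ℝ → ℝ → ℝ} {s1 s2 : ℝ → ℝ}
    (hc : IsConsistent a T K d B ψ1 ψ2 u s1 s2) (hL : 0 < L)
    (hdLip : ∀ x s s' : ℝ, |d x s - d x s'| ≤ L * |s - s'|)
    (hBLip : ∀ x s s' : ℝ, |B x s - B x s'| ≤ L * |s - s'|)
    (hinit : ∀ x ∈ Set.Ioo (0:ℝ) a, u x 0 = u0 x)
    (hDir : ∀ t ∈ Set.Icc (0:ℝ) T, u a t = g t)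
    (hA : A = K + L * (K * (1 + 3 * a)) * (K + 1)) (hα : α = 2 * (3 * a * A + 2 * K))
    (hc₀ : c₀ = Real.exp (α * a)) {M' N : ℕ} (hM' : 0 < M') (hh : 0 < h) (hk : 0 < k)
    (ha : h * (2 * ((M' : ℝ) + 3)) = a) (hkN : N * k = T)
    (hcfl : k / h + 2 * (k / h ^ 2) ≤ 1) (hαh : α * h ≤ 1)
    (hsmall : h * (1 + (α + α ^ 2 + (A + 2 * K) * c₀) * k) ^ N ≤ 1) {W : ℕ → ℕ → ℝ}
    (hW : IsGridSolution h k M' N d B ψ1 ψ2 u0 g W) :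
    ∀ n ≤ N, ∀ i ≤ 2 * (M' + 3), |u ((i : ℝ) * h) ((n : ℝ) * k) - W n i|
      ≤ h * (1 + (α + α ^ 2 + (A + 2 * K) * c₀) * k) ^ n * (1 + α * h)⁻¹ ^ i := by
  have hK1 := hc.one_le
  have hK : 0 < K := by linarith
  have ha0 : 0 < a := by rw [← ha]; positivity
  have hA0 : 0 < A := by rw [hA]; positivity
  have hα0 : 0 < α := by rw [hα]; positivity
  have hc₀0 : 0 < c₀ := by rw [hc₀]; positivity
  set C := α + α ^ 2 + (A + 2 * K) * c₀ with hC
  have hC0 : 0 < C := by positivity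
  set q := (1 + α * h)⁻¹ with hq
  have hq0 : 0 < q := by positivity
  have hq1 : q ≤ 1 := inv_le_one_of_one_le₀ (by nlinarith [mul_pos hα0 hh])
  have hG0 : ∀ n, 0 ≤ h * (1 + C * k) ^ n := fun n => by positivity
  have hGh : ∀ n, h ≤ h * (1 + C * k) ^ n := fun n =>
    le_mul_of_one_le_right hh.le (one_le_pow₀ (by nlinarith [mul_pos hC0 hk]))
  have hG1 : ∀ n ≤ N, h * (1 + C * k) ^ n ≤ 1 := fun n hn =>
    (mul_le_mul_of_nonneg_left (pow_le_pow_right₀ (by nlinarith [mul_pos hC0 hk]) hn) hh.le).trans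
      hsmall
  have ht : ∀ n ≤ N, (n : ℝ) * k ∈ Set.Icc 0 T := fun n hn => by
    refine ⟨by positivity, ?_⟩
    rw [← hkN]
    exact mul_le_mul_of_nonneg_right (by exact_mod_cast hn) hk.le
  have hx : ∀ i, 1 ≤ i → i ≤ 2 * (M' + 3) - 1 → (i : ℝ) * h ∈ Set.Ioo 0 a := fun i h1 h2 => by
    have h1' : (0 : ℝ) < i := by exact_mod_cast h1
    have h2' : (i : ℝ) < 2 * ((M' : ℝ) + 3) := by
      exact_mod_cast (by omega : i < 2 * (M' + 3))
    refine ⟨by positivity, ?_⟩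
    rw [← ha]; nlinarith
  have hx' : ∀ i, 1 ≤ i → i ≤ 2 * (M' + 3) - 1 → (i : ℝ) * h ∈ Set.Icc 0 a :=
    fun i h1 h2 => Set.Ioo_subset_Icc_self (hx i h1 h2)
  have hweight : ∀ i ≤ 2 * (M' + 3), 1 ≤ c₀ * q ^ i := by
    intro i hi
    have h1 : (1 + α * h) ^ i ≤ c₀ := by
      calc (1 + α * h) ^ i ≤ Real.exp (α * h) ^ i :=
            pow_le_pow_left₀ (by positivity) (by linarith [Real.add_one_le_exp (α * h)]) i
        _ = Real.exp (α * (i * h)) := by rw [← Real.exp_nat_mul]; ring_nf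
        _ ≤ c₀ := by
          rw [hc₀, ← ha, mul_comm h]
          have : (i : ℝ) ≤ 2 * ((M' : ℝ) + 3) := by exact_mod_cast hi
          gcongr
    rw [hq, inv_pow, ← div_eq_mul_inv, one_le_div (by positivity)]
    exact h1
  have hle : ∀ G i, 0 ≤ G → G * q ^ i ≤ G := fun G i hG =>
    mul_le_of_le_one_right hG (pow_le_one₀ hq0.le hq1)
  have hclose : ∀ n ≤ N, (∀ i, 1 ≤ i → i ≤ 2 * (M' + 3) - 1 →
      |u ((i : ℝ) * h) ((n : ℝ) * k) - W n i| ≤ h * (1 + C * k) ^ n * q ^ i) →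
      ∀ i ≤ 2 * (M' + 3),
        |u ((i : ℝ) * h) ((n : ℝ) * k) - W n i| ≤ h * (1 + C * k) ^ n * q ^ i := by
    intro n hn hint i hi
    rcases Nat.eq_zero_or_pos i with rfl | hi0
    · rw [pow_zero, mul_one, Nat.cast_zero, zero_mul]
      have hint' : ∀ i, 1 ≤ i → i ≤ 2 * (M' + 3) - 1 →
          |u ((i : ℝ) * h) ((n : ℝ) * k) - W n i| ≤ h * (1 + C * k) ^ n :=
        fun i h1 h2 => (hint i h1 h2).trans (hle _ _ (hG0 n))
      have hs := abs_nonlocal_sub_le (V := W n) hh.le ha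
        (fun i h1 h2 => hc.abs_psi2_le _ (hx' i h1 h2))
        (hc.quad2 _ (ht n hn) h M' hM' hh ha) hint'
      have hD := abs_Qh_le (c := A * (h * (1 + C * k) ^ n)) hh.le ha
        (V := fun i : ℕ => B ((i:ℝ)*h) (s2 (n * k)) * u (i * h) (n * k)
          - B ((i:ℝ)*h) (Qh h M' (fun j => ψ2 ((j:ℝ)*h) * W n j)) * W n i)
        (fun i h1 h2 => by
          rw [hA]
          exact abs_coeff_mul_sub_le hL.le hK.le ha0.le (hGh n) (hG1 n hn)
            (hc.abs_B_le _ (hx' i h1 h2) _ (ht n hn)) (hBLip _ _ _) hs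
            (hc.abs_u_le _ (hx' i h1 h2) _ (ht n hn)) (hint' i h1 h2))
      rw [← Qh_sub, ← mul_assoc] at hD
      have hr := hc.robin _ (ht n hn) h M' hM' hh ha
      have h1 := hint 1 le_rfl (by omega)
      rw [Nat.cast_one, one_mul, pow_one] at h1
      refine abs_boundary_error_le hh hα hα0 hαh (hG0 n) (hGh n) hK.le ?_ hD hr h1
      linarith [hW.left n hn]
    · rcases Nat.lt_or_ge i (2 * (M' + 3)) with hlt | hge
      · exact hint i hi0 (by omega)
      · obtain rfl : i = 2 * (M' + 3) := le_antisymm hi hge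
        have : ((2 * (M' + 3) : ℕ) : ℝ) * h = a := by rw [← ha]; push_cast; ring
        rw [this, hW.right n hn, hDir _ (ht n hn), sub_self, abs_zero]
        exact mul_nonneg (hG0 n) (by positivity)
  intro n
  induction n with
  | zero =>
    refine fun hn => hclose 0 hn fun i h1 h2 => ?_
    rw [hW.init i h1 h2, Nat.cast_zero, zero_mul, hinit _ (hx i h1 h2), sub_self, abs_zero]
    positivity
  | succ n ih =>
    intro hn
    have hn' : n ≤ N := by omega
    have ih := ih hn'
    refine hclose (n + 1) hn fun i h1 h2 => ?_
    have ih' : ∀ i, 1 ≤ i → i ≤ 2 * (M' + 3) - 1 →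
        |u ((i : ℝ) * h) ((n : ℝ) * k) - W n i| ≤ h * (1 + C * k) ^ n :=
      fun i h1 h2 => (ih i (by omega)).trans (hle _ _ (hG0 n))
    have hs := abs_nonlocal_sub_le (V := W n) hh.le ha
      (fun i h1 h2 => hc.abs_psi1_le _ (hx' i h1 h2))
      (hc.quad1 _ (ht n hn') h M' hM' hh ha) ih'
    have hD : |d ((i:ℝ)*h) (s1 (n * k)) * u (i * h) (n * k)
        - d ((i:ℝ)*h) (Qh h M' (fun j => ψ1 ((j:ℝ)*h) * W n j)) * W n i|
        ≤ A * (h * (1 + C * k) ^ n) := by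
      rw [hA]
      exact abs_coeff_mul_sub_le hL.le hK.le ha0.le (hGh n) (hG1 n hn')
        (hc.abs_d_le _ (hx' i h1 h2) _ (ht n hn')) (hdLip _ _ _) hs
        (hc.abs_u_le _ (hx' i h1 h2) _ (ht n hn')) (ih' i h1 h2)
    have hkh : k ≤ h := by
      have : k / h ≤ 1 := by
        have : 0 < k / h ^ 2 := by positivity
        linarith
      rwa [div_le_one hh] at this
    have hr := hc.interior _ (ht n hn') _ (hx i h1 h2) h k hh hk
    have hr' : K * (h + k) ≤ 2 * K * (h * (1 + C * k) ^ n) := by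
      have := mul_le_mul_of_nonneg_left (hGh n) hK.le
      nlinarith
    obtain ⟨j, rfl⟩ : ∃ j, i = j + 1 := ⟨i - 1, by omega⟩
    have he := ih (j + 1) (by omega)
    have hem := ih j (by omega)
    have hep := ih (j + 2) (by omega)
    have hqy : q * (1 + α * h) = 1 := inv_mul_cancel₀ (by positivity)
    have e1 : ((j + 1 : ℕ) : ℝ) * h - h = j * h := by push_cast; ring
    have e2 : ((j + 1 : ℕ) : ℝ) * h + h = (j + 2 : ℕ) * h := by push_cast; ring
    have e3 : (n : ℝ) * k + k = (n + 1 : ℕ) * k := by push_cast; ring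
    rw [e1, e2, e3] at hr
    have hstep := hW.step n (by omega) (j + 1) h1 h2
    rw [Nat.add_sub_cancel, add_assoc j 1 1] at hstep
    have hfin := abs_step_error_le (e' := u ((j + 1 : ℕ) * h) ((n + 1 : ℕ) * k) - W (n + 1) (j + 1))
      hh hk hcfl hα0 (hG0 n) (pow_nonneg hq0.le (j + 1)) hA0.le hK.le (hweight (j + 1) (by omega))
      (by linear_combination -hstep) he
      (hem.trans_eq (by rw [pow_succ, mul_assoc (q ^ j), hqy, mul_one]))
      (hep.trans_eq (by rw [← hq]; ring)) hD (hr.trans hr')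
    exact hfin.trans_eq (by rw [← hC]; ring)

/-- Uniform bound and Lipschitz bound in the first variable on a rectangle. -/
theorem exists_bound_and_lipschitz_fst {F : ℝ → ℝ → ℝ} (hF : ContDiff ℝ 1 (Function.uncurry F))
    (a S : ℝ) : ∃ K, 0 ≤ K ∧ ∀ s, |s| ≤ S → (∀ x ∈ Set.Icc 0 a, |F x s| ≤ K) ∧
      ∀ x ∈ Set.Icc 0 a, ∀ z ∈ Set.Icc 0 a, |F x s - F z s| ≤ K * |x - z| := by
  have hcomp : IsCompact (Set.Icc 0 a ×ˢ Set.Icc (-S) S) := isCompact_Icc.prod isCompact_Icc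
  obtain ⟨K₁, hK₁⟩ := hcomp.exists_bound_of_continuousOn hF.continuous.continuousOn
  obtain ⟨K₂, hK₂⟩ := hF.contDiffOn.exists_lipschitzOnWith one_ne_zero
    ((convex_Icc 0 a).prod (convex_Icc (-S) S)) hcomp
  refine ⟨max 0 (max K₁ K₂), le_max_left _ _, fun s hs => ⟨fun x hx => ?_, fun x hx z hz => ?_⟩⟩
  · exact (hK₁ (x, s) ⟨hx, abs_le.1 hs⟩).trans ((le_max_left _ _).trans (le_max_right _ _))
  · have := hK₂.dist_le_mul (x, s) ⟨hx, abs_le.1 hs⟩ (z, s) ⟨hz, abs_le.1 hs⟩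
    rw [Real.dist_eq, dist_prod_same_right, Real.dist_eq] at this
    exact this.trans (mul_le_mul_of_nonneg_right
      ((le_max_right _ _).trans (le_max_right _ _)) (abs_nonneg _))

theorem abs_mul_sub_mul_le_of_lipschitz {f g : ℝ → ℝ} {s : Set ℝ} {K₁ K₂ : ℝ} (hK₁ : 0 ≤ K₁)
    (hf : ∀ x ∈ s, |f x| ≤ K₁) (hg : ∀ x ∈ s, |g x| ≤ K₂)
    (hfL : ∀ x ∈ s, ∀ z ∈ s, |f x - f z| ≤ K₁ * |x - z|)
    (hgL : ∀ x ∈ s, ∀ z ∈ s, |g x - g z| ≤ K₂ * |x - z|) :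
    ∀ x ∈ s, ∀ z ∈ s, |f x * g x - f z * g z| ≤ 2 * (K₁ * K₂) * |x - z| := by
  intro x hx z hz
  calc _ = |f x * (g x - g z) + (f x - f z) * g z| := by ring_nf
    _ ≤ |f x * (g x - g z)| + |(f x - f z) * g z| := abs_add_le _ _
    _ ≤ K₁ * (K₂ * |x - z|) + K₁ * |x - z| * K₂ := by
      rw [abs_mul, abs_mul]
      exact add_le_add (mul_le_mul (hf x hx) (hgL x hx z hz) (abs_nonneg _) hK₁)
        (mul_le_mul (hfL x hx z hz) (hg z hz) (abs_nonneg _) (by positivity))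
    _ = _ := by ring

theorem deriv_comp_prodMk_left {F : ℝ × ℝ → ℝ} (hF : Differentiable ℝ F) (x t : ℝ) :
    deriv (fun ξ => F (ξ, t)) x = fderiv ℝ F (x, t) (1, 0) :=
  ((hF (x, t)).hasFDerivAt.comp_hasDerivAt x
    ((hasDerivAt_id x).prodMk (hasDerivAt_const x t))).deriv

theorem deriv_comp_prodMk_right {F : ℝ × ℝ → ℝ} (hF : Differentiable ℝ F) (x t : ℝ) :
    deriv (fun τ => F (x, τ)) t = fderiv ℝ F (x, t) (0, 1) :=
  ((hF (x, t)).hasFDerivAt.comp_hasDerivAt t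
    ((hasDerivAt_const t x).prodMk (hasDerivAt_id t))).deriv

/-- Derivative bounds along lines parallel to the first axis. -/
theorem abs_iteratedDeriv_fst_le {u : ℝ → ℝ → ℝ} {m : ℕ} {K : ℝ}
    (hu : ContDiff ℝ m (Function.uncurry u))
    (hK : ∀ p, ‖iteratedFDeriv ℝ m (Function.uncurry u) p‖ ≤ K) (t x : ℝ) :
    |iteratedDeriv m (fun ξ => u ξ t) x| ≤ K := by
  simpa using abs_iteratedDeriv_comp_line_le hu hK (0, t) (ContinuousLinearMap.inl ℝ ℝ ℝ)
    (ContinuousLinearMap.norm_inl_le_one ℝ ℝ ℝ) x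

/-- Derivative bounds along lines parallel to the second axis. -/
theorem abs_iteratedDeriv_snd_le {u : ℝ → ℝ → ℝ} {m : ℕ} {K : ℝ}
    (hu : ContDiff ℝ m (Function.uncurry u))
    (hK : ∀ p, ‖iteratedFDeriv ℝ m (Function.uncurry u) p‖ ≤ K) (x t : ℝ) :
    |iteratedDeriv m (fun τ => u x τ) t| ≤ K := by
  simpa using abs_iteratedDeriv_comp_line_le hu hK (x, 0) (ContinuousLinearMap.inr ℝ ℝ ℝ)
    (ContinuousLinearMap.norm_inr_le_one ℝ ℝ ℝ) t

theorem continuous_integral_mul {a : ℝ} {ψ : ℝ → ℝ} {u : ℝ → ℝ → ℝ} (hψ : Continuous ψ)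
    (hu : Continuous (Function.uncurry u)) :
    Continuous fun t => ∫ x in (0:ℝ)..a, ψ x * u x t := by
  refine intervalIntegral.continuous_parametric_intervalIntegral_of_continuous'
    (f := fun t x => ψ x * u x t) ?_ 0 a
  exact (hψ.comp continuous_snd).mul (hu.comp continuous_swap)

/-- By continuity the equation also holds at the initial time. -/
theorem pde_on_Icc {a T : ℝ} (hT : 0 < T) {d : ℝ → ℝ → ℝ} {u : ℝ → ℝ → ℝ} {s1 : ℝ → ℝ}
    (hd : Continuous (Function.uncurry d)) (hs1 : Continuous s1)
    (hu : ContDiff ℝ 3 (Function.uncurry u))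
    (hPDE : ∀ x ∈ Set.Ioo 0 a, ∀ t ∈ Set.Ioc 0 T,
      deriv (fun τ => u x τ) t + deriv (fun ξ => u ξ t) x + d x (s1 t) * u x t
        = deriv (deriv (fun ξ => u ξ t)) x) :
    ∀ x ∈ Set.Ioo 0 a, ∀ t ∈ Set.Icc 0 T,
      deriv (fun τ => u x τ) t + deriv (fun ξ => u ξ t) x + d x (s1 t) * u x t
        = deriv (deriv (fun ξ => u ξ t)) x := by
  intro x hx
  replace hPDE := hPDE x hx
  set F := Function.uncurry u with hF
  have hu1 : Differentiable ℝ F := hu.differentiable (by norm_num)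
  have hdF : ContDiff ℝ 2 (fderiv ℝ F) := hu.fderiv_right (by norm_num)
  have hG : ContDiff ℝ 2 fun p => fderiv ℝ F p (1, 0) := hdF.clm_apply contDiff_const
  have hpt : Continuous fun t : ℝ => (x, t) := by fun_prop
  have e1 : ∀ t, deriv (fun τ => u x τ) t = fderiv ℝ F (x, t) (0, 1) :=
    fun t => deriv_comp_prodMk_right hu1 x t
  have e2 : ∀ t ξ, deriv (fun ξ => u ξ t) ξ = fderiv ℝ F (ξ, t) (1, 0) :=
    fun t ξ => deriv_comp_prodMk_left hu1 ξ t
  have e3 : ∀ t, deriv (deriv (fun ξ => u ξ t)) x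
      = fderiv ℝ (fun p => fderiv ℝ F p (1, 0)) (x, t) (1, 0) := fun t => by
    rw [funext (e2 t)]
    exact deriv_comp_prodMk_left (hG.differentiable (by norm_num)) x t
  have c1 : Continuous fun t => fderiv ℝ F (x, t) (0, 1) :=
    (hdF.continuous.comp hpt).clm_apply continuous_const
  have c2 : Continuous fun t => fderiv ℝ F (x, t) (1, 0) := hG.continuous.comp hpt
  have c3 : Continuous fun t => fderiv ℝ (fun p => fderiv ℝ F p (1, 0)) (x, t) (1, 0) :=
    ((hG.continuous_fderiv (by norm_num)).comp hpt).clm_apply continuous_const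
  have c4 : Continuous fun t => d x (s1 t) * u x t :=
    (hd.comp (continuous_const.prodMk hs1)).mul (hu.continuous.comp hpt)
  simp only [e1, e2, e3] at hPDE ⊢
  have hclosed : IsClosed {t | fderiv ℝ F (x, t) (0, 1) + fderiv ℝ F (x, t) (1, 0)
      + d x (s1 t) * u x t = fderiv ℝ (fun p => fderiv ℝ F p (1, 0)) (x, t) (1, 0)} :=
    isClosed_eq ((c1.add c2).add c4) c3
  intro t ht
  rw [← closure_Ioc hT.ne] at ht
  exact closure_minimal (fun t ht => hPDE t ht) hclosed ht

theorem abs_truncation_le {a K₂ K₃ : ℝ} {T : ℝ} {d : ℝ → ℝ → ℝ} {u : ℝ → ℝ → ℝ}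
    {s1 : ℝ → ℝ} (hu : ContDiff ℝ 3 (Function.uncurry u))
    (hK₂ : ∀ p, ‖iteratedFDeriv ℝ 2 (Function.uncurry u) p‖ ≤ K₂)
    (hK₃ : ∀ p, ‖iteratedFDeriv ℝ 3 (Function.uncurry u) p‖ ≤ K₃)
    (hPDE : ∀ x ∈ Set.Ioo 0 a, ∀ t ∈ Set.Icc 0 T,
      deriv (fun τ => u x τ) t + deriv (fun ξ => u ξ t) x + d x (s1 t) * u x t
        = deriv (deriv (fun ξ => u ξ t)) x) :
    ∀ t ∈ Set.Icc 0 T, ∀ x ∈ Set.Ioo 0 a, ∀ h k : ℝ, 0 < h → 0 < k →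
    |(u x (t + k) - u x t) / k + (u x t - u (x - h) t) / h + d x (s1 t) * u x t
      - (u (x + h) t + u (x - h) t - 2 * u x t) / h ^ 2| ≤ (K₂ + 2 * K₃) * (h + k) := by
  intro t ht x hx h k hh hk
  have hK₂0 : 0 ≤ K₂ := (norm_nonneg _).trans (hK₂ 0)
  have hK₃0 : 0 ≤ K₃ := (norm_nonneg _).trans (hK₃ 0)
  have hux : ContDiff ℝ 3 fun ξ => u ξ t := hu.comp (contDiff_id.prodMk contDiff_const)
  have hut : ContDiff ℝ 3 fun τ => u x τ := hu.comp (contDiff_const.prodMk contDiff_id)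
  have hu2 : ContDiff ℝ (2 : ℕ) (Function.uncurry u) := hu.of_le (by norm_num)
  have b1 := abs_sub_sub_mul_deriv_le (hut.of_le (by norm_num)) (fun τ => by
    simpa [iteratedDeriv_succ] using abs_iteratedDeriv_snd_le hu2 hK₂ x τ) t k
  have b2 := abs_sub_sub_mul_deriv_le (hux.of_le (by norm_num)) (fun ξ => by
    simpa [iteratedDeriv_succ] using abs_iteratedDeriv_fst_le hu2 hK₂ t ξ) x (-h)
  have b3 := abs_second_difference_sub_le hux (fun ξ => by
    simpa [iteratedDeriv_succ] using abs_iteratedDeriv_fst_le (m := 3) hu hK₃ t ξ) x hh.le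
  have d1 : |(u x (t + k) - u x t) / k - deriv (fun τ => u x τ) t| ≤ K₂ * k := by
    rw [show (u x (t + k) - u x t) / k - deriv (fun τ => u x τ) t
      = (u x (t + k) - u x t - k * deriv (fun τ => u x τ) t) / k by field_simp,
      abs_div, abs_of_pos hk, div_le_iff₀ hk]
    exact b1.trans_eq (by ring)
  have d2 : |(u x t - u (x - h) t) / h - deriv (fun ξ => u ξ t) x| ≤ K₂ * h := by
    rw [show (u x t - u (x - h) t) / h - deriv (fun ξ => u ξ t) x
      = -(u (x + -h) t - u x t - -h * deriv (fun ξ => u ξ t) x) / h by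
        rw [← sub_eq_add_neg]; field_simp; ring,
      abs_div, abs_neg, abs_of_pos hh, div_le_iff₀ hh]
    exact b2.trans_eq (by ring)
  have d3 : |(u (x + h) t + u (x - h) t - 2 * u x t) / h ^ 2
      - deriv (deriv (fun ξ => u ξ t)) x| ≤ 2 * K₃ * h := by
    rw [show (u (x + h) t + u (x - h) t - 2 * u x t) / h ^ 2 - deriv (deriv (fun ξ => u ξ t)) x
      = (u (x + h) t + u (x - h) t - 2 * u x t - h ^ 2 * deriv (deriv (fun ξ => u ξ t)) x) / h ^ 2
        by field_simp,
      abs_div, abs_of_pos (by positivity : 0 < h ^ 2), div_le_iff₀ (by positivity)]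
    exact b3.trans_eq (by ring)
  have hp := hPDE x hx t ht
  have : 0 ≤ K₃ * k := by positivity
  rw [abs_le] at *
  constructor <;> linarith

/-- The scheme is consistent with the boundary value problem. -/
theorem exists_isConsistent {a T : ℝ} (ha : 0 < a) (hT : 0 < T)
    {d B : ℝ → ℝ → ℝ} {ψ1 ψ2 : ℝ → ℝ} {u : ℝ → ℝ → ℝ} {s1 s2 : ℝ → ℝ}
    (hs1 : ∀ t : ℝ, s1 t = ∫ x in (0:ℝ)..a, ψ1 x * u x t)
    (hs2 : ∀ t : ℝ, s2 t = ∫ x in (0:ℝ)..a, ψ2 x * u x t)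
    (hd : ContDiff ℝ 1 (Function.uncurry d)) (hB : ContDiff ℝ 1 (Function.uncurry B))
    (hψ1 : ContDiff ℝ 1 ψ1) (hψ2 : ContDiff ℝ 1 ψ2)
    (hu : ContDiff ℝ 3 (Function.uncurry u))
    (hu_bdd : ∀ m : ℕ, m ≤ 3 → ∃ K : ℝ, ∀ p : ℝ × ℝ,
      ‖iteratedFDeriv ℝ m (Function.uncurry u) p‖ ≤ K)
    (hPDE : ∀ x ∈ Set.Ioo 0 a, ∀ t ∈ Set.Ioc 0 T,
      deriv (fun τ => u x τ) t + deriv (fun ξ => u ξ t) x + d x (s1 t) * u x t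
        = deriv (deriv (fun ξ => u ξ t)) x)
    (hRobin : ∀ t ∈ Set.Icc (0:ℝ) T,
      u 0 t - deriv (fun ξ => u ξ t) 0 = ∫ x in (0:ℝ)..a, B x (s2 t) * u x t) :
    ∃ K, IsConsistent a T K d B ψ1 ψ2 u s1 s2 := by
  have hs1c : Continuous s1 := by
    rw [funext hs1]; exact continuous_integral_mul hψ1.continuous hu.continuous
  have hs2c : Continuous s2 := by
    rw [funext hs2]; exact continuous_integral_mul hψ2.continuous hu.continuous
  obtain ⟨S₁, hS₁⟩ := (isCompact_Icc (a := (0 : ℝ)) (b := T)).exists_bound_of_continuousOn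
    hs1c.continuousOn
  obtain ⟨S₂, hS₂⟩ := (isCompact_Icc (a := (0 : ℝ)) (b := T)).exists_bound_of_continuousOn
    hs2c.continuousOn
  obtain ⟨Ku, hKu0, hKu⟩ := exists_bound_and_lipschitz_fst (hu.of_le (by norm_num)) a T
  obtain ⟨Kd, hKd0, hKd⟩ := exists_bound_and_lipschitz_fst hd a S₁
  obtain ⟨KB, hKB0, hKB⟩ := exists_bound_and_lipschitz_fst hB a S₂
  obtain ⟨Kp, hKp0, hKp⟩ := exists_bound_and_lipschitz_fst (F := fun x _ => ψ1 x)
    (hψ1.comp contDiff_fst) a 0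
  obtain ⟨Kq, hKq0, hKq⟩ := exists_bound_and_lipschitz_fst (F := fun x _ => ψ2 x)
    (hψ2.comp contDiff_fst) a 0
  obtain ⟨K₂, hK₂⟩ := hu_bdd 2 (by norm_num)
  obtain ⟨K₃, hK₃⟩ := hu_bdd 3 (by norm_num)
  have hK₂0 : 0 ≤ K₂ := (norm_nonneg _).trans (hK₂ 0)
  have hK₃0 : 0 ≤ K₃ := (norm_nonneg _).trans (hK₃ 0)
  have hKp := hKp 0 (by simp)
  have hKq := hKq 0 (by simp)
  have hu' : ∀ t ∈ Set.Icc 0 T, |t| ≤ T := fun t ht => by rw [abs_of_nonneg ht.1]; exact ht.2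
  have hquad : ∀ (f : ℝ → ℝ) (Kf : ℝ), 0 ≤ Kf → Continuous f →
      (∀ x ∈ Set.Icc 0 a, |f x| ≤ Kf) →
      (∀ x ∈ Set.Icc 0 a, ∀ z ∈ Set.Icc 0 a, |f x - f z| ≤ Kf * |x - z|) →
      ∀ t ∈ Set.Icc 0 T, ∀ (h : ℝ) (M' : ℕ), 0 < M' → 0 < h → h * (2 * ((M' : ℝ) + 3)) = a →
      |Qh h M' (fun j => f ((j : ℝ) * h) * u ((j : ℝ) * h) t) - ∫ x in (0:ℝ)..a, f x * u x t|
        ≤ 8 * a * (2 * (Kf * Ku)) * h := by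
    intro f Kf hKf0 hfc hf hfL t ht h M' hM' hh hah
    have huc : Continuous fun x => u x t := hu.continuous.comp (by fun_prop : Continuous (·, t))
    exact abs_Qh_sub_integral_le (f := fun x => f x * u x t) hM' (hfc.mul huc) hh.le hah
      (by positivity)
      (abs_mul_sub_mul_le_of_lipschitz hKf0 hf (hKu t (hu' t ht)).1 hfL (hKu t (hu' t ht)).2)
  have hc : 0 ≤ 16 * a * Ku := by positivity
  have hcp : 0 ≤ 16 * a * Ku * Kp := by positivity
  have hcq : 0 ≤ 16 * a * Ku * Kq := by positivity
  have hcB : 0 ≤ 16 * a * Ku * KB := by positivity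
  set K := 1 + Ku + Kd + KB + Kp + Kq + K₂ + 2 * K₃
    + 16 * a * Ku * Kp + 16 * a * Ku * Kq + 16 * a * Ku * KB with hK
  refine ⟨K, ?_, ?_, ?_, ?_, ?_, ?_, ?_, ?_, ?_, ?_⟩
  · linarith
  · exact fun x hx t ht => ((hKu t (hu' t ht)).1 x hx).trans (by linarith)
  · exact fun x hx t ht => ((hKd _ (hS₁ t ht)).1 x hx).trans (by linarith)
  · exact fun x hx t ht => ((hKB _ (hS₂ t ht)).1 x hx).trans (by linarith)
  · exact fun x hx => (hKp.1 x hx).trans (by linarith)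
  · exact fun x hx => (hKq.1 x hx).trans (by linarith)
  · intro t ht h M' hM' hh hah
    rw [hs1 t]
    refine (hquad ψ1 Kp hKp0 hψ1.continuous hKp.1 hKp.2 t ht h M' hM' hh hah).trans ?_
    exact mul_le_mul_of_nonneg_right (by linarith) hh.le
  · intro t ht h M' hM' hh hah
    rw [hs2 t]
    refine (hquad ψ2 Kq hKq0 hψ2.continuous hKq.1 hKq.2 t ht h M' hM' hh hah).trans ?_
    exact mul_le_mul_of_nonneg_right (by linarith) hh.le
  · intro t ht h M' hM' hh hah
    have h1 := hquad (fun x => B x (s2 t)) KB hKB0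
      (hB.continuous.comp (by fun_prop : Continuous (·, s2 t)))
      (hKB _ (hS₂ t ht)).1 (hKB _ (hS₂ t ht)).2 t ht h M' hM' hh hah
    have hux : ContDiff ℝ 3 fun ξ => u ξ t := hu.comp (contDiff_id.prodMk contDiff_const)
    have h2 := abs_sub_sub_mul_deriv_le (hux.of_le (by norm_num)) (fun ξ => by
      simpa [iteratedDeriv_succ] using
        abs_iteratedDeriv_fst_le (m := 2) (hu.of_le (by norm_num)) hK₂ t ξ) 0 h
    rw [zero_add] at h2
    have h3 : |(u h t - u 0 t) / h - deriv (fun ξ => u ξ t) 0| ≤ K₂ * h := by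
      rw [show (u h t - u 0 t) / h - deriv (fun ξ => u ξ t) 0
        = (u h t - u 0 t - h * deriv (fun ξ => u ξ t) 0) / h by field_simp,
        abs_div, abs_of_pos hh, div_le_iff₀ hh]
      exact h2.trans_eq (by ring)
    have h4 : (1 + 1/h) * u 0 t - (1/h) * u h t
      - Qh h M' (fun j => B ((j : ℝ) * h) (s2 t) * u ((j : ℝ) * h) t)
      = -((u h t - u 0 t) / h - deriv (fun ξ => u ξ t) 0)
        - (Qh h M' (fun j => B ((j : ℝ) * h) (s2 t) * u ((j : ℝ) * h) t)
          - ∫ x in (0:ℝ)..a, B x (s2 t) * u x t) := by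
      rw [← hRobin t ht]; ring
    have h5 : 8 * a * (2 * (KB * Ku)) * h ≤ K * h :=
      mul_le_mul_of_nonneg_right (by linarith) hh.le
    have h6 : K₂ * h ≤ K * h := mul_le_mul_of_nonneg_right (by linarith) hh.le
    rw [h4]
    rw [abs_le] at h1 h3 ⊢
    constructor <;> linarith
  · intro t ht x hx h k hh hk
    refine (abs_truncation_le hu hK₂ hK₃ (pde_on_Icc hT hd.continuous hs1c hu hPDE)
      t ht x hx h k hh hk).trans ?_
    exact mul_le_mul_of_nonneg_right (by linarith) (by positivity)

theorem XNorm_le {h k Γ a T : ℝ} {M N : ℕ} {V0 VM : ℕ → ℝ} {V : ℕ → ℕ → ℝ} (hh : 0 ≤ h)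
    (hh1 : h ≤ 1) (hk : 0 ≤ k) (hΓ : 0 ≤ Γ) (hM : (M : ℝ) * h = a) (hN : 0 < N)
    (hkN : N * k = T) (h0 : ∀ n ≤ N, |V0 n| ≤ Γ) (hVM : ∀ n ≤ N, |VM n| ≤ Γ)
    (hV : ∀ n ≤ N, ∀ i, 1 ≤ i → i ≤ M - 1 → |V n i| ≤ Γ) :
    XNorm h k M N V0 V VM ≤ (2 * √(2 * T) + √a) * Γ := by
  have hstar : ∀ Z : ℕ → ℝ, (∀ n ≤ N, |Z n| ≤ Γ) → √(starSq k N Z) ≤ √(2 * T) * Γ := by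
    intro Z hZ
    have h1 : starSq k N Z ≤ 2 * T * Γ ^ 2 := by
      refine (Finset.sum_le_card_nsmul _ _ (k * Γ ^ 2) fun n hn => ?_).trans ?_
      · exact mul_le_mul_of_nonneg_left
          (sq_le_sq.2 (by rw [abs_of_nonneg hΓ]; exact hZ n (by simpa [Nat.lt_succ_iff] using hn)))
          hk
      · rw [Finset.card_range, nsmul_eq_mul, ← hkN]
        have h1N : (1 : ℝ) ≤ N := by exact_mod_cast hN
        have : 0 ≤ k * Γ ^ 2 := by positivity
        push_cast
        nlinarith
    calc √(starSq k N Z) ≤ √(2 * T * Γ ^ 2) := Real.sqrt_le_sqrt h1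
      _ = √(2 * T) * Γ := by rw [Real.sqrt_mul' _ (sq_nonneg _), Real.sqrt_sq hΓ]
  have hsup : Finset.sup' (Finset.range (N+1)) ⟨0, Finset.mem_range.mpr (Nat.succ_pos N)⟩
      (fun n => √(normSq h M (V n))) ≤ √a * Γ := by
    refine Finset.sup'_le _ _ fun n hn => ?_
    have h1 : normSq h M (V n) ≤ a * Γ ^ 2 := by
      refine (Finset.sum_le_card_nsmul _ _ (h * Γ ^ 2) fun i hi => ?_).trans ?_
      · rw [Finset.mem_Icc] at hi
        exact mul_le_mul_of_nonneg_left (sq_le_sq.2 (by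
          rw [abs_of_nonneg hΓ]
          exact hV n (by simpa [Nat.lt_succ_iff] using hn) i hi.1 hi.2)) hh
      · rw [Nat.card_Icc, nsmul_eq_mul, ← hM, mul_assoc]
        refine mul_le_mul_of_nonneg_right ?_ (by positivity)
        exact_mod_cast (by omega : M - 1 + 1 - 1 ≤ M)
    calc √(normSq h M (V n)) ≤ √(a * Γ ^ 2) := Real.sqrt_le_sqrt h1
      _ = √a * Γ := by rw [Real.sqrt_mul' _ (sq_nonneg _), Real.sqrt_sq hΓ]
  have hsum : √(starSq k N V0) + √(starSq k N VM) ≤ 2 * (√(2 * T) * Γ) := by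
    linarith [hstar V0 h0, hstar VM hVM]
  have hsum' : h * (√(starSq k N V0) + √(starSq k N VM)) ≤ 2 * (√(2 * T) * Γ) :=
    (mul_le_of_le_one_left (by positivity) hh1).trans hsum
  unfold XNorm
  linarith

/-- **Convergence for the non-homogeneous problem.** With the Dirichlet condition
`u(a†,t) = g(t)` and the correspondingly modified operator `Φ̃_h`, under the consistency
hypotheses, the mesh coupling `k = r h² = λ h` with `λ + 2r ≤ 1`, and `‖U⁰ - u⁰‖ = O(h)`,
the scheme `Φ̃_h(U_h) = 0` is convergent. -/
theorem stmt_13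
    (adag T : ℝ) (hadag : 0 < adag) (hT : 0 < T)
    (d B : ℝ → ℝ → ℝ) (ψ1 ψ2 u0 : ℝ → ℝ) (u : ℝ → ℝ → ℝ) (s1 s2 : ℝ → ℝ)
    (hs1 : ∀ t : ℝ, s1 t = ∫ x in (0:ℝ)..adag, ψ1 x * u x t)
    (hs2 : ∀ t : ℝ, s2 t = ∫ x in (0:ℝ)..adag, ψ2 x * u x t)
    (hd0 : ∀ x s : ℝ, 0 ≤ d x s) (hB0 : ∀ x s : ℝ, 0 ≤ B x s)
    (hd_smooth : ContDiff ℝ (⊤ : ℕ∞) (Function.uncurry d))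
    (hB_smooth : ContDiff ℝ (⊤ : ℕ∞) (Function.uncurry B))
    (hψ1 : ContDiff ℝ (⊤ : ℕ∞) ψ1) (hψ2 : ContDiff ℝ (⊤ : ℕ∞) ψ2) (hu0 : ContDiff ℝ (⊤ : ℕ∞) u0)
    (L : ℝ) (hL : 0 < L)
    (hdLip : ∀ x s s' : ℝ, |d x s - d x s'| ≤ L * |s - s'|)
    (hBLip : ∀ x s s' : ℝ, |B x s - B x s'| ≤ L * |s - s'|)
    (hu : ContDiff ℝ 3 (Function.uncurry u))
    (hu_bdd : ∀ m : ℕ, m ≤ 3 → ∃ K : ℝ, ∀ p : ℝ × ℝ,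
      ‖iteratedFDeriv ℝ m (Function.uncurry u) p‖ ≤ K)
    (hPDE : ∀ x ∈ Set.Ioo 0 adag, ∀ t ∈ Set.Ioc 0 T,
      deriv (fun τ => u x τ) t + deriv (fun ξ => u ξ t) x + d x (s1 t) * u x t
        = deriv (deriv (fun ξ => u ξ t)) x)
    (hRobin : ∀ t ∈ Set.Icc (0:ℝ) T,
      u 0 t - deriv (fun ξ => u ξ t) 0 = ∫ x in (0:ℝ)..adag, B x (s2 t) * u x t)
    (hinit : ∀ x ∈ Set.Ioo (0:ℝ) adag, u x 0 = u0 x)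
    (g : ℝ → ℝ) (hg : ContDiff ℝ (⊤ : ℕ∞) g)
    (hDir : ∀ t ∈ Set.Icc (0:ℝ) T, u adag t = g t)
    (hO : ∃ C1 > 0, ∀ M' : ℕ, 0 < M' →
      Real.sqrt (normSq (adag / (2*(M'+3) : ℝ)) (2*(M'+3))
          (fun i => u0 ((i:ℝ) * (adag / (2*(M'+3) : ℝ)))
            - u ((i:ℝ) * (adag / (2*(M'+3) : ℝ))) 0))
        ≤ C1 * (adag / (2*(M'+3) : ℝ))) :
    ∃ h₀ > 0, ∀ ε > 0, ∃ h₁ > 0, ∀ M' N : ℕ, 0 < M' → 0 < N →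
      ∀ r lam : ℝ, 0 < r → 0 < lam →
      let M := 2*(M'+3); let h := adag / (M : ℝ); let k := T / (N : ℝ);
      k = r * h^2 → k = lam * h → lam + 2*r ≤ 1 → h ≤ h₀ →
      ∃ (U0 : ℕ → ℝ) (U : ℕ → ℕ → ℝ) (UM : ℕ → ℝ),
        SolvesG adag T d B ψ1 ψ2 u0 g M' N U0 U UM ∧
        (h ≤ h₁ →
          XNorm h k M N (fun n => u 0 ((n:ℝ)*k) - U0 n)
              (fun n i => u ((i:ℝ)*h) ((n:ℝ)*k) - U n i)
              (fun n => u adag ((n:ℝ)*k) - UM n) ≤ ε) := by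
  obtain ⟨K, hc⟩ := exists_isConsistent hadag hT hs1 hs2 (hd_smooth.of_le (by norm_cast))
    (hB_smooth.of_le (by norm_cast)) (hψ1.of_le (by norm_cast)) (hψ2.of_le (by norm_cast))
    hu hu_bdd hPDE hRobin
  have hK : 0 < K := one_pos.trans_le hc.one_le
  obtain ⟨A, hA⟩ : ∃ A, A = K + L * (K * (1 + 3 * adag)) * (K + 1) := ⟨_, rfl⟩
  have hA0 : 0 < A := by rw [hA]; positivity
  obtain ⟨α, hα⟩ : ∃ α, α = 2 * (3 * adag * A + 2 * K) := ⟨_, rfl⟩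
  have hα0 : 0 < α := by rw [hα]; positivity
  obtain ⟨c₀, hc₀⟩ : ∃ c₀, c₀ = Real.exp (α * adag) := ⟨_, rfl⟩
  have hc₀0 : 0 < c₀ := by rw [hc₀]; positivity
  obtain ⟨C, hC⟩ : ∃ C, C = α + α ^ 2 + (A + 2 * K) * c₀ := ⟨_, rfl⟩
  have hC0 : 0 < C := by rw [hC]; positivity
  obtain ⟨E, hE⟩ : ∃ E, E = Real.exp (C * T) := ⟨_, rfl⟩
  have hE0 : 0 < E := by rw [hE]; positivity
  have hS : 0 < 2 * √(2 * T) + √adag := by positivity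
  refine ⟨1, one_pos, fun ε hε =>
    ⟨min (1 / α) (min (1 / E) (ε / ((2 * √(2 * T) + √adag) * E))), by positivity, ?_⟩⟩
  intro M' N hM' hN r lam hr hlam M h k hkr hkl hcfl hh1
  have hM0 : (0 : ℝ) < (M : ℝ) := by simp only [M]; positivity
  have hN0 : (0 : ℝ) < N := by exact_mod_cast hN
  have hh : 0 < h := div_pos hadag hM0
  have hk : 0 < k := div_pos hT hN0
  have hMh : (M : ℝ) * h = adag := mul_div_cancel₀ _ hM0.ne'
  have ha : h * (2 * ((M' : ℝ) + 3)) = adag := by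
    rw [← hMh, mul_comm]; simp only [M]; push_cast; ring
  have hkN : N * k = T := mul_div_cancel₀ _ hN0.ne'
  obtain ⟨W, hW⟩ := exists_isGridSolution hh hk M' N d B ψ1 ψ2 u0 g
  refine ⟨_, W, _, hW.solvesG, fun hle => ?_⟩
  rw [le_min_iff, le_min_iff, le_div_iff₀ hα0, le_div_iff₀ hE0, le_div_iff₀ (by positivity)] at hle
  obtain ⟨hle₁, hle₂, hle₃⟩ := hle
  have hcfl' : k / h + 2 * (k / h ^ 2) ≤ 1 := by
    rwa [(div_eq_iff hh.ne').2 hkl, (div_eq_iff (by positivity)).2 hkr]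
  have hpow : ∀ n ≤ N, (1 + C * k) ^ n ≤ E := fun n hn => by
    calc (1 + C * k) ^ n ≤ (1 + C * k) ^ N :=
          pow_le_pow_right₀ (by nlinarith [mul_pos hC0 hk]) hn
      _ ≤ Real.exp (C * k) ^ N :=
        pow_le_pow_left₀ (by positivity) (by linarith [Real.add_one_le_exp (C * k)]) N
      _ = E := by rw [hE, ← Real.exp_nat_mul, ← hkN]; ring_nf
  have herr := hc.abs_error_le (c₀ := c₀) hL hdLip hBLip hinit hDir hA hα hc₀ hM' hh hk ha hkN
    hcfl' (by linarith) (by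
      rw [← hC]; exact (mul_le_mul_of_nonneg_left (hpow N le_rfl) hh.le).trans hle₂) hW
  have herr' : ∀ n ≤ N, ∀ i ≤ M, |u ((i : ℝ) * h) ((n : ℝ) * k) - W n i| ≤ h * E := by
    intro n hn i hi
    refine (herr n hn i hi).trans ?_
    rw [← hC]
    refine (mul_le_of_le_one_right (by positivity) (pow_le_one₀ (by positivity) ?_)).trans
      (mul_le_mul_of_nonneg_left (hpow n hn) hh.le)
    exact inv_le_one_of_one_le₀ (by nlinarith [mul_pos hα0 hh])
  refine (XNorm_le hh.le hh1 hk.le (by positivity : 0 ≤ h * E) hMh hN hkN (fun n hn => ?_)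
    (fun n hn => ?_) fun n hn i _ hi => herr' n hn i (by omega)).trans (le_trans (by linarith) hle₃)
  · simpa using herr' n hn 0 (Nat.zero_le _)
  · simpa only [hMh] using herr' n hn M le_rfl
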